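/- Let μ be a probability measure on [0,1] with μ({0,1}) = 0, let θ have law μ, let X̄_n have law P[X̄_n = k/n] = C(n,k) ∫_0^1 t^k (1-t)^{n-k} μ(dt), and let Z be a standard normal random variable independent of θ. Then for every n ≥ 1, | d_W(X̄_n, θ) − d_W(θ + √(θ(1−θ)/n) Z, θ) | ≤ E[θ² + (1−θ)²]/n. -/

import Mathlib

open MeasureTheory ProbabilityTheory Set

/-- Wasserstein distance between two laws on ℝ (dual formulation):
`d_W(μ,ν) = sup over 1-Lipschitz φ of |∫φ dμ - ∫φ dν|`. -/
noncomputable def dW (μ ν : Measure ℝ) : ℝ :=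
  ⨆ φ : {f : ℝ → ℝ // LipschitzWith 1 f}, |(∫ x, φ.1 x ∂μ) - ∫ x, φ.1 x ∂ν|

/-- Law of the empirical mean `X̄ₙ` of the first `n` terms of an exchangeable 0-1 sequence
with de Finetti mixing measure `μ` : `P[X̄ₙ = k/n] = C(n,k) ∫ t^k (1-t)^(n-k) dμ(t)`. -/
noncomputable def barLaw (μ : Measure ℝ) (n : ℕ) : Measure ℝ :=
  ∑ k ∈ Finset.range (n + 1),
    (ENNReal.ofReal ((n.choose k : ℝ) * ∫ t, t ^ k * (1 - t) ^ (n - k) ∂μ)) •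
      Measure.dirac ((k : ℝ) / n)

/-- Law of `θ + √(θ(1-θ)/n)·Z` where `θ ~ μ` and `Z` is an independent standard normal. -/
noncomputable def perturbedLaw (μ : Measure ℝ) (n : ℕ) : Measure ℝ :=
  Measure.map (fun q : ℝ × ℝ => q.1 + Real.sqrt (q.1 * (1 - q.1) / n) * q.2)
    (μ.prod (gaussianReal 0 1))

open Filter Topology in
lemma tendsto_gaussianPDFReal_atBot :
    Tendsto (gaussianPDFReal 0 1) atBot (𝓝 0) := by
  have h : Tendsto (fun x : ℝ => x ^ 2 / 2) atBot atTop :=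
    (by simpa [Function.comp_def] using
      (tendsto_pow_atTop (α := ℝ) two_ne_zero).comp tendsto_abs_atBot_atTop :
      Tendsto (fun x : ℝ => x ^ 2) atBot atTop).atTop_div_const (by norm_num)
  have := (Real.tendsto_exp_neg_atTop_nhds_zero.comp h).const_mul ((√(2 * Real.pi))⁻¹)
  simpa [gaussianPDFReal_def, Function.comp_def, neg_div] using this

lemma hasDerivAt_gaussianPDFReal (x : ℝ) :
    HasDerivAt (gaussianPDFReal 0 1) (-x * gaussianPDFReal 0 1 x) x := by
  have h : HasDerivAt (fun y : ℝ => -(y - 0) ^ 2 / (2 * ((1 : NNReal) : ℝ))) (-x) x := by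
    exact ((((hasDerivAt_id x).sub_const 0).pow 2).neg.div_const
      (2 * ((1 : NNReal) : ℝ))).congr_deriv (by simp; ring)
  have := h.exp.const_mul ((√(2 * Real.pi * (1 : NNReal)))⁻¹)
  rw [gaussianPDFReal_def]
  exact this.congr_deriv (by ring)

lemma continuous_gaussianPDFReal : Continuous (gaussianPDFReal 0 1) :=
  continuous_iff_continuousAt.2 fun x => (hasDerivAt_gaussianPDFReal x).continuousAt

lemma gaussianPDFReal_zero_neg (x : ℝ) : gaussianPDFReal 0 1 (-x) = gaussianPDFReal 0 1 x := by
  simp [gaussianPDFReal_def]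

lemma gaussianPDFReal_std_pos (x : ℝ) : 0 < gaussianPDFReal 0 1 x :=
  gaussianPDFReal_pos 0 1 x one_ne_zero

lemma hasDerivAt_integral_Iic {F : ℝ → ℝ} (hF : Continuous F) (hi : Integrable F) (x : ℝ) :
    HasDerivAt (fun y => ∫ t in Iic y, F t) (F x) x := by
  have h := (hF.integral_hasStrictDerivAt 0 x).hasDerivAt.const_add (∫ t in Iic 0, F t)
  refine h.congr_of_eventuallyEq (Filter.Eventually.of_forall fun y => ?_)
  simp only
  rw [← intervalIntegral.integral_Iic_sub_Iic hi.integrableOn hi.integrableOn]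
  ring

lemma integrable_mul_gaussianPDFReal {φ : ℝ → ℝ} (h : Integrable φ (gaussianReal 0 1)) :
    Integrable fun x => φ x * gaussianPDFReal 0 1 x := by
  rw [gaussianReal_of_var_ne_zero 0 one_ne_zero,
    integrable_withDensity_iff_integrable_smul' (measurable_gaussianPDF 0 1)
      (ae_of_all _ fun _ => gaussianPDF_lt_top)] at h
  simpa [toReal_gaussianPDF, mul_comm] using h

lemma integral_mul_gaussianPDFReal (φ : ℝ → ℝ) :
    ∫ x, φ x * gaussianPDFReal 0 1 x = ∫ x, φ x ∂(gaussianReal 0 1) := by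
  rw [integral_gaussianReal_eq_integral_smul one_ne_zero]
  simp [mul_comm]

lemma integrable_id_gaussianReal : Integrable (fun x : ℝ => x) (gaussianReal 0 1) :=
  (memLp_id_gaussianReal 1).integrable le_rfl

lemma abs_lipschitz_sub_le {φ : ℝ → ℝ} (hφ : LipschitzWith 1 φ) (x y : ℝ) :
    |φ x - φ y| ≤ |x - y| := by
  simpa [Real.dist_eq] using hφ.dist_le_mul x y

lemma integrable_lipschitz_gaussianReal {φ : ℝ → ℝ} (hφ : LipschitzWith 1 φ) :
    Integrable φ (gaussianReal 0 1) := by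
  refine (integrable_id_gaussianReal.abs.add (integrable_const |φ 0|)).mono'
    hφ.continuous.aestronglyMeasurable (ae_of_all _ fun x => ?_)
  have h1 := abs_lipschitz_sub_le hφ x 0
  have h2 := abs_sub_abs_le_abs_sub (φ x) (φ 0)
  simp only [sub_zero] at h1
  simp only [Real.norm_eq_abs, Pi.add_apply]
  linarith

lemma setIntegral_Iic_id_mul_gaussianPDFReal (x : ℝ) :
    ∫ t in Iic x, t * gaussianPDFReal 0 1 t = -gaussianPDFReal 0 1 x := by
  have h := integral_Iic_of_hasDerivAt_of_tendsto' (a := x) (m := 0)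
    (f := fun t => -gaussianPDFReal 0 1 t) (f' := fun t => t * gaussianPDFReal 0 1 t)
    (fun t _ => (hasDerivAt_gaussianPDFReal t).neg.congr_deriv (by ring))
    (integrable_mul_gaussianPDFReal integrable_id_gaussianReal).integrableOn
    (by simpa using tendsto_gaussianPDFReal_atBot.neg)
  simpa using h

/-- Mills' inequality for the left tail of the standard normal distribution. -/
lemma mills_Iic (x : ℝ) :
    0 ≤ (1 + x ^ 2) * (∫ t in Iic x, gaussianPDFReal 0 1 t) + x * gaussianPDFReal 0 1 x := by
  set P : ℝ → ℝ := fun y => ∫ t in Iic y, gaussianPDFReal 0 1 t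
  set A : ℝ → ℝ := fun y => P y + y / (1 + y ^ 2) * gaussianPDFReal 0 1 y with hA
  have hd : ∀ y, HasDerivAt A (2 * gaussianPDFReal 0 1 y / (1 + y ^ 2) ^ 2) y := by
    intro y
    have hy : (1 + y ^ 2 : ℝ) ≠ 0 := by positivity
    have h1 : HasDerivAt P _ y :=
      hasDerivAt_integral_Iic continuous_gaussianPDFReal (integrable_gaussianPDFReal 0 1) y
    have h2 := (hasDerivAt_id y).div (((hasDerivAt_id y).pow 2).const_add 1) hy
    have h3 := h1.add (h2.mul (hasDerivAt_gaussianPDFReal y))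
    refine h3.congr_deriv ?_
    simp
    field_simp
    ring
  have hmono : Monotone A := by
    refine monotone_of_deriv_nonneg (fun y => (hd y).differentiableAt) fun y => ?_
    rw [(hd y).deriv]
    have := gaussianPDFReal_std_pos y
    positivity
  have hlow : ∀ y, -gaussianPDFReal 0 1 y ≤ A y := by
    intro y
    have h0 : 0 ≤ P y := setIntegral_nonneg measurableSet_Iic fun t _ => gaussianPDFReal_nonneg 0 1 t
    have h1 : -1 ≤ y / (1 + y ^ 2) := by
      rw [le_div_iff₀ (by positivity)]
      nlinarith [sq_nonneg (y + 1)]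
    have := gaussianPDFReal_std_pos y
    simp only [hA]
    nlinarith
  have hA0 : 0 ≤ A x := by
    have ht := tendsto_gaussianPDFReal_atBot.neg
    rw [neg_zero] at ht
    refine le_of_tendsto ht ?_
    filter_upwards [Filter.eventually_le_atBot x] with y hy
    exact (hlow y).trans (hmono hy)
  have : (1 + x ^ 2) * P x + x * gaussianPDFReal 0 1 x = (1 + x ^ 2) * A x := by
    simp only [hA]
    field_simp
  rw [this]
  positivity

/-- Mills' inequality for the right tail of the standard normal distribution. -/
lemma mills_Ioi (x : ℝ) :
    0 ≤ (1 + x ^ 2) * (∫ t in Ioi x, gaussianPDFReal 0 1 t) - x * gaussianPDFReal 0 1 x := by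
  have h := mills_Iic (-x)
  rw [← integral_comp_neg_Ioi] at h
  simp only [gaussianPDFReal_zero_neg, neg_sq] at h
  linarith

/-- If `H` is nondecreasing and centred for the standard normal law, then the derivative of
`x ↦ x * f x`, with `f` the solution of the Stein equation for `H`, is nonpositive. -/
lemma stein_monotone_nonpos {H : ℝ → ℝ} (hm : Monotone H)
    (hi : Integrable fun x => H x * gaussianPDFReal 0 1 x)
    (h0 : ∫ x, H x * gaussianPDFReal 0 1 x = 0) (x : ℝ) :
    (1 + x ^ 2) * (∫ t in Iic x, H t * gaussianPDFReal 0 1 t)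
      + x * H x * gaussianPDFReal 0 1 x ≤ 0 := by
  have hp := integrable_gaussianPDFReal 0 1
  have hq : (0 : ℝ) < 1 + x ^ 2 := by positivity
  rcases le_total (H x) 0 with hx | hx
  · have h1 : ∫ t in Iic x, H t * gaussianPDFReal 0 1 t
        ≤ H x * ∫ t in Iic x, gaussianPDFReal 0 1 t := by
      rw [← integral_const_mul]
      refine setIntegral_mono_on hi.integrableOn (hp.const_mul _).integrableOn measurableSet_Iic
        fun t ht => ?_
      exact mul_le_mul_of_nonneg_right (hm ht) (gaussianPDFReal_nonneg 0 1 t)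
    have h2 := mul_nonpos_of_nonpos_of_nonneg hx (mills_Iic x)
    have h3 := mul_le_mul_of_nonneg_left h1 hq.le
    linarith
  · have h1 : H x * ∫ t in Ioi x, gaussianPDFReal 0 1 t
        ≤ ∫ t in Ioi x, H t * gaussianPDFReal 0 1 t := by
      rw [← integral_const_mul]
      refine setIntegral_mono_on (hp.const_mul _).integrableOn hi.integrableOn measurableSet_Ioi
        fun t ht => ?_
      exact mul_le_mul_of_nonneg_right (hm (le_of_lt ht)) (gaussianPDFReal_nonneg 0 1 t)
    have h2 := mul_nonneg hx (mills_Ioi x)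
    have h3 := mul_le_mul_of_nonneg_left h1 hq.le
    have h4 := intervalIntegral.integral_Iic_add_Ioi (b := x) hi.integrableOn hi.integrableOn
    rw [h0] at h4
    have h5 : ∫ t in Iic x, H t * gaussianPDFReal 0 1 t
      = -∫ t in Ioi x, H t * gaussianPDFReal 0 1 t := by linarith
    rw [h5]
    linarith

/-- Stein's equation for a `1`-Lipschitz test function has a solution whose derivative is
`2`-Lipschitz. -/
lemma exists_stein_solution {φ : ℝ → ℝ} (hφ : LipschitzWith 1 φ) :
    ∃ f g : ℝ → ℝ, (∀ x, HasDerivAt f (g x) x) ∧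
      (∀ x, g x = x * f x + φ x - ∫ z, φ z ∂(gaussianReal 0 1)) ∧
      ∀ x y, |g x - g y| ≤ 2 * |x - y| := by
  set N := ∫ z, φ z ∂(gaussianReal 0 1) with hN
  set p := gaussianPDFReal 0 1 with hp
  set H : ℝ → ℝ := fun x => φ x - N with hH
  have hHi : Integrable H (gaussianReal 0 1) :=
    (integrable_lipschitz_gaussianReal hφ).sub (integrable_const N)
  have hHp : Integrable fun x => H x * p x := integrable_mul_gaussianPDFReal hHi
  have hxp : Integrable fun x => x * p x := integrable_mul_gaussianPDFReal integrable_id_gaussianReal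
  have hH0 : ∫ x, H x * p x = 0 := by
    rw [hp, integral_mul_gaussianPDFReal,
      integral_sub (integrable_lipschitz_gaussianReal hφ) (integrable_const N)]
    simp [hN]
  have hx0 : ∫ x, x * p x = 0 := by
    rw [hp, integral_mul_gaussianPDFReal, integral_id_gaussianReal]
  have hHc : Continuous H := hφ.continuous.sub continuous_const
  have hpp : ∀ x, 0 < p x := gaussianPDFReal_std_pos
  set I : ℝ → ℝ := fun x => ∫ t in Iic x, H t * p t with hI
  set f : ℝ → ℝ := fun x => I x / p x with hf
  have hId : ∀ x, HasDerivAt I (H x * p x) x :=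
    hasDerivAt_integral_Iic (hHc.mul continuous_gaussianPDFReal) hHp
  have hfd : ∀ x, HasDerivAt f (x * f x + H x) x := by
    intro x
    have h := (hId x).div (hasDerivAt_gaussianPDFReal x) (hpp x).ne'
    refine h.congr_deriv ?_
    have := (hpp x).ne'
    simp only [hf, ← hp]
    field_simp
    ring
  have hkd : ∀ x, HasDerivAt (fun y => y * f y) ((1 + x ^ 2) * f x + x * H x) x := by
    intro x
    have h := (hasDerivAt_id x).mul (hfd x)
    refine h.congr_deriv ?_
    simp
    ring
  have hbound : ∀ x, |(1 + x ^ 2) * f x + x * H x| ≤ 1 := by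
    intro x
    have hfx : f x * p x = I x := by
      have := (hpp x).ne'
      simp only [hf]
      field_simp
    have hid := setIntegral_Iic_id_mul_gaussianPDFReal x
    rw [← hp] at hid
    have h1 := stein_monotone_nonpos (H := fun t => H t + t)
      (by
        intro a b hab
        have h := abs_le.1 (abs_lipschitz_sub_le hφ a b)
        rw [abs_of_nonpos (sub_nonpos.2 hab)] at h
        simp only [hH]
        linarith)
      ((hHp.add hxp).congr (ae_of_all _ fun t => (add_mul _ _ _).symm))
      (by simp only [add_mul]; rw [integral_add hHp hxp, hH0, hx0, add_zero]) x
    have h2 := stein_monotone_nonpos (H := fun t => t - H t)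
      (by
        intro a b hab
        have h := abs_le.1 (abs_lipschitz_sub_le hφ a b)
        rw [abs_of_nonpos (sub_nonpos.2 hab)] at h
        simp only [hH]
        linarith)
      ((hxp.sub hHp).congr (ae_of_all _ fun t => (sub_mul _ _ _).symm))
      (by simp only [sub_mul]; rw [integral_sub hxp hHp, hH0, hx0, sub_zero]) x
    simp only [add_mul (H _), sub_mul _ (H _), ← hp] at h1 h2
    rw [integral_add hHp.integrableOn hxp.integrableOn, hid] at h1
    rw [integral_sub hxp.integrableOn hHp.integrableOn, hid] at h2
    change _ * (I x + _) + _ ≤ _ at h1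
    change _ * (_ - I x) + _ ≤ _ at h2
    rw [← hfx] at h1 h2
    rw [abs_le]
    constructor
    · refine le_of_mul_le_mul_right ?_ (hpp x)
      linarith
    · refine le_of_mul_le_mul_right ?_ (hpp x)
      linarith
  refine ⟨f, fun x => x * f x + H x, hfd, fun x => by simp only [hH]; ring, fun x y => ?_⟩
  have h1 : |x * f x - y * f y| ≤ |x - y| := by
    have := convex_univ.norm_image_sub_le_of_norm_hasDerivWithin_le (C := 1)
      (fun z _ => (hkd z).hasDerivWithinAt) (fun z _ => hbound z) (mem_univ y) (mem_univ x)
    simpa using this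
  have h2 := abs_lipschitz_sub_le hφ x y
  calc |x * f x + H x - (y * f y + H y)| = |(x * f x - y * f y) + (φ x - φ y)| := by
        simp only [hH]; ring_nf
    _ ≤ _ := abs_add_le _ _
    _ ≤ 2 * |x - y| := by linarith

/-- First-order Taylor estimate for a function whose derivative is `2`-Lipschitz. -/
lemma abs_taylor_le {f g : ℝ → ℝ} (hf : ∀ x, HasDerivAt f (g x) x)
    (hg : ∀ x y, |g x - g y| ≤ 2 * |x - y|) (a b : ℝ) :
    |f b - f a - (b - a) * g a| ≤ (b - a) ^ 2 := by
  have hd : ∀ u : ℝ, HasDerivAt (fun u => f (a + u * (b - a)) - f a - u * ((b - a) * g a))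
      ((b - a) * (g (a + u * (b - a)) - g a)) u := by
    intro u
    have h1 : HasDerivAt (fun u : ℝ => a + u * (b - a)) (b - a) u := by
      simpa using ((hasDerivAt_id u).mul_const (b - a)).const_add a
    have h2 := (((hf _).comp u h1).sub_const (f a)).sub
      ((hasDerivAt_id u).mul_const ((b - a) * g a))
    exact h2.congr_deriv (by ring)
  have h := image_norm_le_of_norm_deriv_right_le_deriv_boundary (a := 0) (b := 1)
    (f := fun u => f (a + u * (b - a)) - f a - u * ((b - a) * g a))
    (B := fun u => u ^ 2 * (b - a) ^ 2) (B' := fun u => 2 * u * (b - a) ^ 2)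
    (fun u _ => (hd u).continuousAt.continuousWithinAt) (fun u _ => (hd u).hasDerivWithinAt)
    (by simp) (fun u => by simpa using (hasDerivAt_pow 2 u).mul_const ((b - a) ^ 2))
    (fun u hu => by
      have h1 := hg (a + u * (b - a)) a
      rw [add_sub_cancel_left, abs_mul, abs_of_nonneg hu.1] at h1
      rw [Real.norm_eq_abs, abs_mul, ← sq_abs (b - a)]
      nlinarith [abs_nonneg (b - a)]) (right_mem_Icc.2 zero_le_one)
  simpa using h

/-- The binomial probability weights. -/
noncomputable def binomialWeight (n : ℕ) (t : ℝ) (k : ℕ) : ℝ :=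
  n.choose k * (t ^ k * (1 - t) ^ (n - k))

lemma sum_binomialWeight (n : ℕ) (t : ℝ) :
    ∑ k ∈ Finset.range (n + 1), binomialWeight n t k = 1 := by
  have h := add_pow t (1 - t) n
  rw [add_sub_cancel, one_pow] at h
  rw [h]
  exact Finset.sum_congr rfl fun k _ => mul_comm _ _

lemma binomialWeight_nonneg {t : ℝ} (ht : t ∈ Icc (0 : ℝ) 1) (n k : ℕ) :
    0 ≤ binomialWeight n t k :=
  mul_nonneg (Nat.cast_nonneg _)
    (mul_nonneg (pow_nonneg ht.1 _) (pow_nonneg (sub_nonneg.2 ht.2) _))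

lemma sum_mul_binomialWeight (m : ℕ) (t : ℝ) (G : ℕ → ℝ) :
    ∑ k ∈ Finset.range (m + 2), (k : ℝ) * binomialWeight (m + 1) t k * G k =
      (m + 1) * t * ∑ k ∈ Finset.range (m + 1), binomialWeight m t k * G (k + 1) := by
  rw [Finset.sum_range_succ', Finset.mul_sum]
  simp only [Nat.cast_zero, zero_mul, add_zero]
  refine Finset.sum_congr rfl fun k _ => ?_
  have h : ((m : ℝ) + 1) * m.choose k = (m + 1).choose (k + 1) * (k + 1) := by
    exact_mod_cast Nat.add_one_mul_choose_eq m k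
  simp only [binomialWeight, Nat.add_sub_add_right, pow_succ, Nat.cast_add, Nat.cast_one]
  linear_combination (-(t ^ k * t * (1 - t) ^ (m - k) * G (k + 1))) * h

lemma sum_sub_mul_binomialWeight (m : ℕ) (t : ℝ) (G : ℕ → ℝ) :
    ∑ k ∈ Finset.range (m + 2), ((m : ℝ) + 1 - k) * binomialWeight (m + 1) t k * G k =
      (m + 1) * (1 - t) * ∑ k ∈ Finset.range (m + 1), binomialWeight m t k * G k := by
  rw [Finset.sum_range_succ, Finset.mul_sum]
  simp only [Nat.cast_add, Nat.cast_one, sub_self, zero_mul, add_zero]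
  refine Finset.sum_congr rfl fun k hk => ?_
  have hk' : k ≤ m := Nat.lt_succ_iff.1 (Finset.mem_range.1 hk)
  have h : (m.choose k : ℝ) * (m + 1) = (m + 1).choose k * (m + 1 - k) := by
    have := congrArg (Nat.cast (R := ℝ)) (Nat.choose_mul_succ_eq m k)
    rw [Nat.cast_mul, Nat.cast_mul, Nat.cast_sub (by omega)] at this
    simpa using this
  simp only [binomialWeight, Nat.succ_sub hk', pow_succ]
  linear_combination (-(t ^ k * (1 - t) ^ (m - k) * (1 - t) * G k)) * h

/-- Conditioning a binomial variable on its last trial. -/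
lemma sum_binomialWeight_succ (m : ℕ) (t : ℝ) (G : ℕ → ℝ) :
    ∑ k ∈ Finset.range (m + 2), binomialWeight (m + 1) t k * G k =
      ∑ k ∈ Finset.range (m + 1), binomialWeight m t k * ((1 - t) * G k + t * G (k + 1)) := by
  have hm : (m + 1 : ℝ) ≠ 0 := by positivity
  refine mul_left_cancel₀ hm ?_
  calc (m + 1 : ℝ) * ∑ k ∈ Finset.range (m + 2), binomialWeight (m + 1) t k * G k
      = ∑ k ∈ Finset.range (m + 2), (k : ℝ) * binomialWeight (m + 1) t k * G k
        + ∑ k ∈ Finset.range (m + 2), ((m : ℝ) + 1 - k) * binomialWeight (m + 1) t k * G k := by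
        rw [← Finset.sum_add_distrib, Finset.mul_sum]
        exact Finset.sum_congr rfl fun k _ => by ring
    _ = _ := by
        rw [sum_mul_binomialWeight, sum_sub_mul_binomialWeight]
        simp only [Finset.mul_sum]
        rw [← Finset.sum_add_distrib]
        exact Finset.sum_congr rfl fun k _ => by ring

/-- Stein's identity for the binomial distribution. -/
lemma sum_centered_binomialWeight (m : ℕ) (t : ℝ) (G : ℕ → ℝ) :
    ∑ k ∈ Finset.range (m + 2), binomialWeight (m + 1) t k * (((k : ℝ) - (m + 1) * t) * G k) =
      (m + 1) * (t * (1 - t)) *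
        ∑ k ∈ Finset.range (m + 1), binomialWeight m t k * (G (k + 1) - G k) := by
  calc _ = (1 - t) * ∑ k ∈ Finset.range (m + 2), (k : ℝ) * binomialWeight (m + 1) t k * G k
        - t * ∑ k ∈ Finset.range (m + 2),
          ((m : ℝ) + 1 - k) * binomialWeight (m + 1) t k * G k := by
        simp only [Finset.mul_sum]
        rw [← Finset.sum_sub_distrib]
        exact Finset.sum_congr rfl fun k _ => by ring
    _ = _ := by
        rw [sum_mul_binomialWeight, sum_sub_mul_binomialWeight]
        simp only [Finset.mul_sum]
        rw [← Finset.sum_sub_distrib]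
        exact Finset.sum_congr rfl fun k _ => by ring

/-- Normal approximation of the binomial distribution in Wasserstein distance. -/
lemma binomial_normal_approx {φ : ℝ → ℝ} (hφ : LipschitzWith 1 φ) {n : ℕ} (hn : 1 ≤ n)
    {t : ℝ} (ht : t ∈ Ioo (0 : ℝ) 1) :
    |∑ k ∈ Finset.range (n + 1), binomialWeight n t k * φ ((k : ℝ) / n)
      - ∫ z, φ (t + √(t * (1 - t) / n) * z) ∂(gaussianReal 0 1)| ≤
      (t ^ 2 + (1 - t) ^ 2) / n := by
  obtain ⟨m, rfl⟩ : ∃ m, n = m + 1 := ⟨n - 1, by omega⟩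
  have ht1 : 0 < 1 - t := sub_pos.2 ht.2
  have hn0 : (0 : ℝ) < (m + 1 : ℕ) := by positivity
  set c := √(t * (1 - t) / (m + 1 : ℕ)) with hc
  have hc0 : 0 < c := Real.sqrt_pos.2 (div_pos (mul_pos ht.1 ht1) hn0)
  have hc2 : t * (1 - t) = (m + 1) * c ^ 2 := by
    rw [hc, Real.sq_sqrt (div_pos (mul_pos ht.1 ht1) hn0).le]
    push_cast
    field_simp
  have hψ : LipschitzWith 1 (fun w => φ (t + c * w) / c) := by
    refine LipschitzWith.of_dist_le_mul fun x y => ?_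
    have h := abs_lipschitz_sub_le hφ (t + c * x) (t + c * y)
    rw [add_sub_add_left_eq_sub, ← mul_sub, abs_mul, abs_of_pos hc0] at h
    rw [Real.dist_eq, Real.dist_eq, ← sub_div, abs_div, abs_of_pos hc0, div_le_iff₀ hc0]
    simp only [NNReal.coe_one, one_mul]
    linarith
  obtain ⟨f, g, hfd, hg, hgl⟩ := exists_stein_solution hψ
  rw [integral_div] at hg
  set N := ∫ z, φ (t + c * z) ∂(gaussianReal 0 1)
  set w : ℕ → ℝ := fun k => ((k : ℝ) / (m + 1 : ℕ) - t) / c with hw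
  set h : ℝ := 1 / ((m + 1) * c) with hh
  have hh0 : 0 < h := by positivity
  have hwφ : ∀ k : ℕ, φ ((k : ℝ) / (m + 1 : ℕ)) - N
      = c * g (w k) - h * c * (((k : ℝ) - (m + 1) * t) * f (w k)) := by
    intro k
    have e : t + c * w k = (k : ℝ) / (m + 1 : ℕ) := by
      simp only [hw]
      field_simp
      ring
    have e2 : h * c * ((k : ℝ) - (m + 1) * t) = c * w k := by
      simp only [hw, hh]
      push_cast
      field_simp
    have e3 := hg (w k)
    rw [e] at e3
    rw [← mul_assoc, e2, e3]
    field_simp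
    ring
  have hws : ∀ k, w (k + 1) = w k + h := by
    intro k
    simp only [hw, hh]
    push_cast
    field_simp
    ring
  have hstep : ∀ k, |c * ((1 - t) * g (w k) + t * g (w (k + 1)))
      - c / h * (f (w (k + 1)) - f (w k))| ≤ (t ^ 2 + (1 - t) ^ 2) / (m + 1 : ℕ) := by
    intro k
    have h1 := abs_taylor_le hfd hgl (w k) (w k + (1 - t) * h)
    have h2 := abs_taylor_le hfd hgl (w (k + 1)) (w k + (1 - t) * h)
    rw [hws] at h2 ⊢
    have e : c * ((1 - t) * g (w k) + t * g (w k + h)) - c / h * (f (w k + h) - f (w k))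
        = c / h * ((f (w k + (1 - t) * h) - f (w k + h)
            - (w k + (1 - t) * h - (w k + h)) * g (w k + h))
          - (f (w k + (1 - t) * h) - f (w k) - (w k + (1 - t) * h - w k) * g (w k))) := by
      field_simp
      ring
    have e2 : (t ^ 2 + (1 - t) ^ 2) / (m + 1 : ℕ) = c / h * ((t ^ 2 + (1 - t) ^ 2) * h ^ 2) := by
      simp only [hh]
      push_cast
      field_simp
    have hch : 0 < c / h := div_pos hc0 hh0
    rw [e, e2, abs_mul, abs_of_pos hch]
    refine mul_le_mul_of_nonneg_left ((abs_sub _ _).trans ?_) hch.le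
    nlinarith
  have hsum : ∑ k ∈ Finset.range (m + 1 + 1),
        binomialWeight (m + 1) t k * φ ((k : ℝ) / (m + 1 : ℕ)) - N
      = ∑ k ∈ Finset.range (m + 1), binomialWeight m t k *
        (c * ((1 - t) * g (w k) + t * g (w (k + 1))) - c / h * (f (w (k + 1)) - f (w k))) := by
    calc _ = ∑ k ∈ Finset.range (m + 2),
          binomialWeight (m + 1) t k * (φ ((k : ℝ) / (m + 1 : ℕ)) - N) := by
          simp only [mul_sub, Finset.sum_sub_distrib, ← Finset.sum_mul]
          rw [sum_binomialWeight, one_mul]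
      _ = c * ∑ k ∈ Finset.range (m + 2), binomialWeight (m + 1) t k * g (w k)
          - h * c * ∑ k ∈ Finset.range (m + 2),
            binomialWeight (m + 1) t k * (((k : ℝ) - (m + 1) * t) * f (w k)) := by
          rw [Finset.mul_sum, Finset.mul_sum, ← Finset.sum_sub_distrib]
          refine Finset.sum_congr rfl fun k _ => ?_
          rw [hwφ]
          ring
      _ = _ := by
          rw [sum_binomialWeight_succ m t (fun k => g (w k)),
            sum_centered_binomialWeight m t (fun k => f (w k)), hc2, Finset.mul_sum,
            Finset.mul_sum, Finset.mul_sum, ← Finset.sum_sub_distrib]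
          refine Finset.sum_congr rfl fun k _ => ?_
          have e : h * c * ((m + 1) * ((m + 1) * c ^ 2)) = c / h := by
            simp only [hh]
            field_simp
          linear_combination (-(binomialWeight m t k * (f (w (k + 1)) - f (w k)))) * e
  rw [hsum]
  refine (Finset.abs_sum_le_sum_abs _ _).trans ?_
  have hb : ∀ k, 0 ≤ binomialWeight m t k := binomialWeight_nonneg ⟨ht.1.le, ht.2.le⟩ m
  calc _ ≤ ∑ k ∈ Finset.range (m + 1),
        binomialWeight m t k * ((t ^ 2 + (1 - t) ^ 2) / (m + 1 : ℕ)) := by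
        refine Finset.sum_le_sum fun k _ => ?_
        rw [abs_mul, abs_of_nonneg (hb k)]
        exact mul_le_mul_of_nonneg_left (hstep k) (hb k)
    _ = _ := by rw [← Finset.sum_mul, sum_binomialWeight, one_mul]

lemma abs_iSup_sub_iSup_le {ι : Type*} [Nonempty ι] {a b : ι → ℝ} {C : ℝ}
    (ha : BddAbove (range a)) (h : ∀ i, |a i - b i| ≤ C) :
    |(⨆ i, a i) - ⨆ i, b i| ≤ C := by
  have hb : BddAbove (range b) := by
    obtain ⟨M, hM⟩ := ha
    refine ⟨M + C, ?_⟩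
    rintro _ ⟨i, rfl⟩
    have h1 := hM (mem_range_self i)
    have h2 := (abs_le.1 (h i)).1
    linarith
  rw [abs_sub_le_iff]
  constructor
  · rw [sub_le_iff_le_add]
    refine ciSup_le fun i => ?_
    have h1 := le_ciSup hb i
    have h2 := (abs_le.1 (h i)).2
    linarith
  · rw [sub_le_iff_le_add]
    refine ciSup_le fun i => ?_
    have h1 := le_ciSup ha i
    have h2 := (abs_le.1 (h i)).1
    linarith

lemma integrable_of_continuous_of_ae_mem_Icc {μ : Measure ℝ} [IsFiniteMeasure μ]
    (hμ : ∀ᵐ t ∂μ, t ∈ Icc (0 : ℝ) 1) {f : ℝ → ℝ} (hf : Continuous f) : Integrable f μ := by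
  obtain ⟨C, hC⟩ := isCompact_Icc.exists_bound_of_continuousOn (s := Icc (0 : ℝ) 1) hf.continuousOn
  exact (integrable_const C).mono' hf.aestronglyMeasurable (hμ.mono hC)

lemma continuous_binomialWeight (n k : ℕ) : Continuous fun t => binomialWeight n t k := by
  unfold binomialWeight
  fun_prop

lemma integral_barLaw {μ : Measure ℝ} [IsProbabilityMeasure μ]
    (hμ : ∀ᵐ t ∂μ, t ∈ Icc (0 : ℝ) 1) (n : ℕ) (φ : ℝ → ℝ) :
    ∫ x, φ x ∂(barLaw μ n) =
      ∫ t, ∑ k ∈ Finset.range (n + 1), binomialWeight n t k * φ ((k : ℝ) / n) ∂μ := by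
  have hi : ∀ k, Integrable (fun t => binomialWeight n t k) μ := fun k =>
    integrable_of_continuous_of_ae_mem_Icc hμ (continuous_binomialWeight n k)
  rw [barLaw, integral_finsetSum_measure
    fun k _ => (integrable_dirac (by simp)).smul_measure ENNReal.ofReal_ne_top,
    integral_finsetSum _ fun k _ => (hi k).mul_const _]
  refine Finset.sum_congr rfl fun k _ => ?_
  rw [integral_smul_measure, integral_dirac, integral_mul_const, smul_eq_mul,
    ← integral_const_mul, ENNReal.toReal_ofReal]
  · rfl
  · exact integral_nonneg_of_ae (hμ.mono fun t ht => binomialWeight_nonneg ht n k)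

lemma integrable_perturbed {μ : Measure ℝ} [IsProbabilityMeasure μ]
    (hμ : ∀ᵐ t ∂μ, t ∈ Icc (0 : ℝ) 1) (n : ℕ) {φ : ℝ → ℝ} (hφ : LipschitzWith 1 φ) :
    Integrable (fun q : ℝ × ℝ => φ (q.1 + √(q.1 * (1 - q.1) / n) * q.2))
      (μ.prod (gaussianReal 0 1)) := by
  have hz := integrable_id_gaussianReal.abs.comp_snd μ
  refine ((hz.const_mul (√(1 / n))).add (integrable_const (|φ 0| + 1))).mono'
    (hφ.continuous.comp (by fun_prop)).aestronglyMeasurable ?_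
  filter_upwards [Measure.quasiMeasurePreserving_fst.ae hμ] with q hq
  have h1 := abs_lipschitz_sub_le hφ (q.1 + √(q.1 * (1 - q.1) / n) * q.2) 0
  have h2 := abs_sub_abs_le_abs_sub (φ (q.1 + √(q.1 * (1 - q.1) / n) * q.2)) (φ 0)
  have h3 := abs_add_le q.1 (√(q.1 * (1 - q.1) / n) * q.2)
  have h4 : √(q.1 * (1 - q.1) / n) ≤ √(1 / n) := by
    refine Real.sqrt_le_sqrt (div_le_div_of_nonneg_right ?_ (Nat.cast_nonneg n))
    nlinarith [hq.1, hq.2]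
  have h5 := mul_le_mul_of_nonneg_right h4 (abs_nonneg q.2)
  rw [abs_mul, abs_of_nonneg (Real.sqrt_nonneg _), abs_of_nonneg hq.1] at h3
  have h6 := hq.2
  simp only [Real.norm_eq_abs, Pi.add_apply, sub_zero] at *
  linarith

lemma integral_perturbedLaw {μ : Measure ℝ} [IsProbabilityMeasure μ]
    (hμ : ∀ᵐ t ∂μ, t ∈ Icc (0 : ℝ) 1) (n : ℕ) {φ : ℝ → ℝ} (hφ : LipschitzWith 1 φ) :
    ∫ x, φ x ∂(perturbedLaw μ n) =
      ∫ t, ∫ z, φ (t + √(t * (1 - t) / n) * z) ∂(gaussianReal 0 1) ∂μ := by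
  rw [perturbedLaw, integral_map (by fun_prop) hφ.continuous.aestronglyMeasurable,
    integral_prod _ (integrable_perturbed hμ n hφ)]

lemma abs_integral_barLaw_sub_le {μ : Measure ℝ} [IsProbabilityMeasure μ]
    (hμ : ∀ᵐ t ∂μ, t ∈ Icc (0 : ℝ) 1) (n : ℕ) {φ : ℝ → ℝ} (hφ : LipschitzWith 1 φ) :
    |(∫ x, φ x ∂(barLaw μ n)) - ∫ x, φ x ∂μ| ≤ 1 := by
  have hi : Integrable
      (fun t => ∑ k ∈ Finset.range (n + 1), binomialWeight n t k * φ ((k : ℝ) / n)) μ :=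
    integrable_of_continuous_of_ae_mem_Icc hμ
      (continuous_finsetSum _ fun k _ => (continuous_binomialWeight n k).mul_const _)
  rw [integral_barLaw hμ,
    ← integral_sub hi (integrable_of_continuous_of_ae_mem_Icc hμ hφ.continuous)]
  have h := norm_integral_le_of_norm_le_const (μ := μ) (C := 1)
    (f := fun t => ∑ k ∈ Finset.range (n + 1), binomialWeight n t k * φ ((k : ℝ) / n) - φ t) ?_
  · simpa using h
  filter_upwards [hμ] with t ht
  have e : ∑ k ∈ Finset.range (n + 1), binomialWeight n t k * φ ((k : ℝ) / n) - φ t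
      = ∑ k ∈ Finset.range (n + 1), binomialWeight n t k * (φ ((k : ℝ) / n) - φ t) := by
    simp only [mul_sub, Finset.sum_sub_distrib, ← Finset.sum_mul]
    rw [sum_binomialWeight, one_mul]
  rw [e, Real.norm_eq_abs, ← sum_binomialWeight n t]
  refine (Finset.abs_sum_le_sum_abs _ _).trans (Finset.sum_le_sum fun k hk => ?_)
  have hb := binomialWeight_nonneg ht n k
  rw [abs_mul, abs_of_nonneg hb]
  refine mul_le_of_le_one_right hb ((abs_lipschitz_sub_le hφ _ _).trans ?_)
  have hk0 : (0 : ℝ) ≤ (k : ℝ) / n := by positivity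
  have hk1 : (k : ℝ) / n ≤ 1 :=
    div_le_one_of_le₀ (by exact_mod_cast Nat.lt_succ_iff.1 (Finset.mem_range.1 hk))
      (Nat.cast_nonneg n)
  rw [abs_le]
  constructor <;> linarith [ht.1, ht.2]

lemma abs_integral_barLaw_sub_perturbedLaw_le {μ : Measure ℝ} [IsProbabilityMeasure μ]
    (hμ : ∀ᵐ t ∂μ, t ∈ Ioo (0 : ℝ) 1) {n : ℕ} (hn : 1 ≤ n) {φ : ℝ → ℝ}
    (hφ : LipschitzWith 1 φ) :
    |(∫ x, φ x ∂(barLaw μ n)) - ∫ x, φ x ∂(perturbedLaw μ n)| ≤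
      (∫ t, t ^ 2 + (1 - t) ^ 2 ∂μ) / n := by
  have hμ' : ∀ᵐ t ∂μ, t ∈ Icc (0 : ℝ) 1 := hμ.mono fun t ht => Ioo_subset_Icc_self ht
  have hi : Integrable
      (fun t => ∑ k ∈ Finset.range (n + 1), binomialWeight n t k * φ ((k : ℝ) / n)) μ :=
    integrable_of_continuous_of_ae_mem_Icc hμ'
      (continuous_finsetSum _ fun k _ => (continuous_binomialWeight n k).mul_const _)
  rw [integral_barLaw hμ', integral_perturbedLaw hμ' n hφ,
    ← integral_sub hi (integrable_perturbed hμ' n hφ).integral_prod_left, ← integral_div]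
  rw [← Real.norm_eq_abs]
  refine norm_integral_le_of_norm_le
    (integrable_of_continuous_of_ae_mem_Icc hμ'
    (f := fun t : ℝ => (t ^ 2 + (1 - t) ^ 2) / n) (by fun_prop)) ?_
  filter_upwards [hμ] with t ht
  exact binomial_normal_approx hφ hn ht

/-- Equivalent formulation with a perturbed version of the prior: if `μ({0,1}) = 0` then
`|d_W(X̄ₙ, θ) - d_W(θ + √(θ(1-θ)/n)Z, θ)| ≤ E[θ² + (1-θ)²]/n`. -/
theorem stmt_3 (μ : Measure ℝ) [IsProbabilityMeasure μ]
    (hsupp : μ (Set.Icc (0 : ℝ) 1)ᶜ = 0) (h01 : μ ({0, 1} : Set ℝ) = 0)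
    (n : ℕ) (hn : 1 ≤ n) :
    |dW (barLaw μ n) μ - dW (perturbedLaw μ n) μ| ≤
      (∫ t, t ^ 2 + (1 - t) ^ 2 ∂μ) / n := by
  have hμ : ∀ᵐ t ∂μ, t ∈ Ioo (0 : ℝ) 1 := by
    have h1 : ∀ᵐ t ∂μ, t ∈ Icc (0 : ℝ) 1 := hsupp
    have h2 : ∀ᵐ t ∂μ, t ∉ ({0, 1} : Set ℝ) := measure_eq_zero_iff_ae_notMem.1 h01
    filter_upwards [h1, h2] with t ht ht'
    simp only [mem_insert_iff, mem_singleton_iff, not_or] at ht'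
    exact ⟨lt_of_le_of_ne ht.1 (Ne.symm ht'.1), lt_of_le_of_ne ht.2 ht'.2⟩
  have : Nonempty {f : ℝ → ℝ // LipschitzWith 1 f} := ⟨⟨id, LipschitzWith.id⟩⟩
  refine abs_iSup_sub_iSup_le ⟨1, ?_⟩ fun φ => ?_
  · rintro _ ⟨φ, rfl⟩
    exact abs_integral_barLaw_sub_le (hμ.mono fun t ht => Ioo_subset_Icc_self ht) n φ.2
  · refine (abs_abs_sub_abs_le_abs_sub _ _).trans ?_
    rw [sub_sub_sub_cancel_right]
    exact abs_integral_barLaw_sub_perturbedLaw_le hμ hn φ.2
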